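/- arXiv:2101.00779 — 2 statements merged into one kernel-verified Lean document; each statement's English description precedes it below -/
import Mathlib

section
/- Let t ≥ 2 and n ≥ 2 be integers with n ≤ 2^t − 1. Then every t-colouring of the edges of the complete graph K_n contains a Hamilton path (a path on all n vertices) avoiding some colour, i.e., a path on n vertices none of whose edges has colour i, for some i ∈ {1,...,t}. -/
/-- There is a path on `ℓ` vertices in the complete graph on `Fin n`, all of whose edges
avoid colour `i` under the edge-colouring `c`. -/
def AvoidsPath (n t ℓ : ℕ) (c : Sym2 (Fin n) → Fin t) (i : Fin t) : Prop :=
  ∃ P : Fin ℓ → Fin n, Function.Injective P ∧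
    ∀ k : ℕ, ∀ h : k + 1 < ℓ, c s(P ⟨k, Nat.lt_of_succ_lt h⟩, P ⟨k + 1, h⟩) ≠ i

/-- Every `t`-colouring of the edges of `K_n` contains, for some colour `i`,
a path on `L i` vertices avoiding colour `i`. -/
def IsChromRamsey (t : ℕ) (L : Fin t → ℕ) (n : ℕ) : Prop :=
  ∀ c : Sym2 (Fin n) → Fin t, ∃ i : Fin t, AvoidsPath n t (L i) c i

/-- `p(L)`: the least `n` such that every `t`-colouring of `K_n` contains, for some colour `i`,
a path on `L i` vertices avoiding colour `i`. -/
noncomputable def pRamsey (t : ℕ) (L : Fin t → ℕ) : ℕ := sInf {n | IsChromRamsey t L n}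

/-- `s(L) = ⌊(L₁ + 2·L₂ + ⋯ + 2^(t-1)·L_t - 2) / (2^t - 2)⌋`. -/
def sVal (t : ℕ) (L : Fin t → ℕ) : ℕ :=
  ((∑ i : Fin t, 2 ^ (i : ℕ) * L i) - 2) / (2 ^ t - 2)

/-- Some cyclic ordering of all the vertices has consecutive vertices adjacent. -/
def SimpleGraph.HasSpanningCycle {W : Type*} (G : SimpleGraph W) : Prop :=
  ∃ s : Cycle W, s.Nodup ∧ (∀ w, w ∈ s) ∧ s.Chain G.Adj

namespace SimpleGraph

variable {W : Type*} {G : SimpleGraph W}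

namespace HasSpanningCycle

/-- A spanning path from `u` to `v` passing through consecutive vertices `x` and `y` can be closed
up to a spanning cycle if `u` is adjacent to `y` and `x` is adjacent to `v`. -/
theorem of_crossing {A B : List W} {u v x y : W}
    (hnd : (A ++ B).Nodup) (hmem : ∀ w, w ∈ A ++ B) (hchain : (A ++ B).IsChain G.Adj)
    (hu : A.head? = some u) (hx : A.getLast? = some x)
    (hy : B.head? = some y) (hv : B.getLast? = some v)
    (huy : G.Adj u y) (hxv : G.Adj x v) : G.HasSpanningCycle := by
  obtain ⟨A', rfl⟩ : ∃ A', A = u :: A' := by cases A <;> simp_all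
  obtain ⟨B', rfl⟩ : ∃ B', B = y :: B' := by cases B <;> simp_all
  have hflip : (fun a b => G.Adj b a) = G.Adj := by
    ext a b; exact G.adj_comm b a
  rw [List.isChain_append] at hchain
  refine ⟨((u :: A') ++ (y :: B').reverse : List W), ?_, ?_, ?_⟩
  · rw [Cycle.nodup_coe_iff]
    exact (List.Perm.append_left _ (List.reverse_perm _)).nodup_iff.2 hnd
  · intro w
    have := hmem w
    simp only [Cycle.mem_coe_iff, List.mem_append, List.mem_reverse] at this ⊢
    exact this
  · rw [Cycle.chain_ne_nil _ (by simp), List.isChain_cons, List.isChain_append,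
      List.isChain_reverse, hflip]
    refine ⟨?_, hchain.1, hchain.2.1, ?_⟩
    · intro z hz
      simp at hz
      simpa [← hz] using huy.symm
    · intro p hp q hq
      rw [List.head?_reverse, hv] at hq
      rw [hx] at hp
      simp at hp hq
      rwa [← hp, ← hq]

theorem isChain_of_sup_edge {u v : W} {l : List W} (hl : l.IsChain (G ⊔ edge u v).Adj)
    (hu : u ∉ l) : l.IsChain G.Adj := by
  refine List.IsChain.imp_of_mem_imp (fun a b ha hb hab => ?_) hl
  rw [sup_adj, edge_adj] at hab
  grind

/-- If adding `uv` creates a spanning cycle, there was a spanning cycle before, or a spanning path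
from `u` to `v`. -/
theorem exists_path [Fintype W] (hN : 3 ≤ Fintype.card W) {u v : W}
    (h : (G ⊔ edge u v).HasSpanningCycle) (hG : ¬ G.HasSpanningCycle) :
    ∃ l : List W, l.Nodup ∧ (∀ w, w ∈ l) ∧ l.IsChain G.Adj ∧ l.head? = some u ∧
      l.getLast? = some v := by
  obtain ⟨s, hnd, hmem, hchain⟩ := h
  obtain ⟨l, rfl⟩ : ∃ l : List W, s = ((u :: l : List W) : Cycle W) := by
    induction s using Quotient.inductionOn' with | _ m
    obtain ⟨m₁, m₂, rfl⟩ := List.append_of_mem (show u ∈ m from hmem u)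
    exact ⟨m₂ ++ m₁, Cycle.coe_eq_coe.2 (by
      rw [← List.cons_append]; exact List.isRotated_append)⟩
  rw [Cycle.nodup_coe_iff, List.nodup_cons] at hnd
  have hmem' : ∀ w, w = u ∨ w ∈ l := fun w => by simpa using hmem w
  have hlen : 3 ≤ (u :: l).length := by
    classical
    refine hN.trans ?_
    rw [← List.toFinset_card_of_nodup (List.nodup_cons.2 hnd), ← Finset.card_univ]
    exact Finset.card_le_card fun w _ => by simpa using hmem' w
  rw [Cycle.chain_coe_cons, List.isChain_cons, List.isChain_append] at hchain
  obtain ⟨hhead, hl, -, hlast⟩ := hchain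
  replace hl := isChain_of_sup_edge hl hnd.1
  obtain ⟨a, m, rfl⟩ : ∃ a m, l = a :: m := by cases l <;> simp_all
  obtain ⟨m', b, hm⟩ : ∃ m' b, m = m' ++ [b] := by
    refine ⟨_, _, (List.dropLast_append_getLast (l := m) ?_).symm⟩
    rintro rfl
    simp at hlen
  subst hm
  have hab : a ≠ b := by
    rintro rfl; simp at hnd
  have hua : u ≠ a ∧ u ≠ b := by
    simp at hnd; tauto
  simp [edge_adj] at hhead hlast
  have key : (G.Adj u a ∧ G.Adj b u) ∨ (G.Adj u a ∧ b = v) ∨ (G.Adj b u ∧ a = v) := by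
    have h2 := hlast b (by simp [List.getLast?_cons])
    grind
  rcases key with ⟨h1, h2⟩ | ⟨h1, rfl⟩ | ⟨h1, rfl⟩
  · refine absurd ⟨_, Cycle.nodup_coe_iff.2 (List.nodup_cons.2 hnd), hmem, ?_⟩ hG
    rw [Cycle.chain_coe_cons, List.isChain_cons, List.isChain_append]
    refine ⟨by simpa using h1, hl, by simp, ?_⟩
    simpa [List.getLast?_cons] using h2
  · refine ⟨_, List.nodup_cons.2 hnd, fun w => List.mem_cons.2 (hmem' w), ?_, rfl, ?_⟩
    · exact List.isChain_cons.2 ⟨by simpa using h1, hl⟩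
    · simp [List.getLast?_cons]
  · refine ⟨u :: (a :: (m' ++ [b])).reverse, ?_, ?_, ?_, rfl, ?_⟩
    · rw [List.nodup_cons, List.nodup_reverse, List.mem_reverse]; exact hnd
    · intro w; rw [List.mem_cons, List.mem_reverse]; exact hmem' w
    · rw [List.isChain_cons, List.isChain_reverse]
      refine ⟨by simpa [eq_comm] using h1.symm, hl.imp fun _ _ h => h.symm⟩
    · simp [List.getLast?_cons]

theorem of_top [Fintype W] (hN : 3 ≤ Fintype.card W) : (⊤ : SimpleGraph W).HasSpanningCycle := by
  obtain ⟨l, hl⟩ : ∃ l : List W, l = Finset.univ.toList := ⟨_, rfl⟩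
  have hnd : l.Nodup := hl ▸ Finset.nodup_toList _
  have hlen : l.length = Fintype.card W := by rw [hl, Finset.length_toList, Finset.card_univ]
  refine ⟨l, Cycle.nodup_coe_iff.2 hnd, fun w => by simp [hl], ?_⟩
  obtain ⟨a, m, rfl⟩ : ∃ a m, l = a :: m := by
    cases l
    · simp at hlen; omega
    · simp
  rw [Cycle.chain_coe_cons, List.isChain_cons, List.isChain_append]
  rw [List.nodup_cons] at hnd
  have hm : m ≠ [] := by
    rintro rfl
    simp at hlen; omega
  refine ⟨?_, ?_, by simp, ?_⟩
  · intro y hy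
    rw [List.head?_append_of_ne_nil _ hm] at hy
    rw [top_adj]
    rintro rfl
    exact hnd.1 (List.mem_of_mem_head? hy)
  · exact (List.nodup_iff_pairwise_ne.1 hnd.2).isChain.imp fun _ _ h => (top_adj _ _).2 h
  · intro x hx y hy
    rw [top_adj]
    rintro rfl
    simp at hy
    subst hy
    exact hnd.1 (List.mem_of_mem_getLast? hx)

end HasSpanningCycle

open Classical in
/-- **Chvátal's degree condition**: a graph without a spanning cycle has, for some `h` less than half
the number `N` of vertices, at least `h` vertices of degree at most `h` and at least `N - h` vertices
of degree less than `N - h`. -/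
theorem exists_le_card_degree_le_of_not_hasSpanningCycle [Fintype W] (hN : 3 ≤ Fintype.card W)
    (hG : ¬ G.HasSpanningCycle) (hpos : ∀ w, 0 < G.degree w) :
    ∃ h, 0 < h ∧ 2 * h < Fintype.card W ∧ h ≤ Finset.card {w | G.degree w ≤ h} ∧
      Fintype.card W ≤ Finset.card {w | G.degree w + h < Fintype.card W} + h := by
  obtain ⟨G', hle, hmax⟩ :=
    (Set.toFinite {G' : SimpleGraph W | ¬ G'.HasSpanningCycle}).exists_le_maximal hG
  have hdeg : ∀ w, G.degree w ≤ G'.degree w := fun w => degree_le_of_le hle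
  obtain ⟨p, hp⟩ : ∃ p : W × W, MaximalFor (· ∈ {p : W × W | p.1 ≠ p.2 ∧ ¬ G'.Adj p.1 p.2})
      (fun p => G'.degree p.1 + G'.degree p.2) p := by
    refine (Set.toFinite _).exists_maximalFor _ _ ?_
    by_contra hne
    rw [Set.not_nonempty_iff_eq_empty] at hne
    refine hmax.prop ?_
    convert HasSpanningCycle.of_top hN
    rw [eq_top_iff]
    intro a b hab
    by_contra hab'
    exact hne.subset (show (a, b) ∈ _ from ⟨hab, hab'⟩)
  obtain ⟨u, v, huv, hnadj, hle', hsum⟩ : ∃ u v, u ≠ v ∧ ¬ G'.Adj u v ∧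
      G'.degree u ≤ G'.degree v ∧ ∀ x y, x ≠ y → ¬ G'.Adj x y →
        G'.degree x + G'.degree y ≤ G'.degree u + G'.degree v := by
    have hp₂ : ∀ x y, x ≠ y → ¬ G'.Adj x y →
        G'.degree x + G'.degree y ≤ G'.degree p.1 + G'.degree p.2 := fun x y hxy hadj =>
      not_lt.1 fun hlt => (hp.not_prop_of_gt (j := (x, y)) hlt) ⟨hxy, hadj⟩
    obtain ⟨h₁, h₂⟩ := hp.prop
    rcases le_total (G'.degree p.1) (G'.degree p.2) with h | h
    · exact ⟨p.1, p.2, h₁, h₂, h, hp₂⟩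
    · exact ⟨p.2, p.1, h₁.symm, fun h => h₂ h.symm, h, fun x y hxy hadj => by
        rw [add_comm (G'.degree p.2)]; exact hp₂ x y hxy hadj⟩
  have hcyc : (G' ⊔ edge u v).HasSpanningCycle := by
    by_contra hcon
    have := hmax.le_of_ge (y := G' ⊔ edge u v) hcon le_sup_left
    refine hnadj (this ?_)
    rw [sup_adj, edge_adj]
    exact Or.inr ⟨Or.inl ⟨rfl, rfl⟩, huv⟩
  obtain ⟨l, hnd, hmem, hchain, hu, hv⟩ := HasSpanningCycle.exists_path hN hcyc hmax.prop
  have hpred : ∀ y : G'.neighborFinset u, ∃ i, ∃ h : i + 1 < l.length, l[i + 1] = y := by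
    rintro ⟨y, hy⟩
    obtain ⟨j, hj, rfl⟩ := List.mem_iff_getElem.1 (hmem y)
    rw [mem_neighborFinset] at hy
    cases j with
    | zero =>
      rw [List.head?_eq_getElem?, List.getElem?_eq_getElem hj] at hu
      simp at hu
      rw [hu] at hy
      exact absurd hy (G'.irrefl)
    | succ i => exact ⟨i, hj, rfl⟩
  choose ix hix hixe using hpred
  have hvlast : ∀ i, ∀ h : i + 1 < l.length, l[i] ≠ v := by
    intro i h hiv
    rw [← hiv, List.getLast?_eq_getElem?, List.getElem?_eq_getElem (by omega)] at hv
    simp only [Option.some.injEq] at hv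
    have := (hnd.getElem_inj_iff).1 hv
    omega
  let f : G'.neighborFinset u → W := fun y => l[ix y]'(by have := hix y; omega)
  have hf : Function.Injective f := by
    intro y z hyz
    have := (hnd.getElem_inj_iff).1 hyz
    ext
    rw [← hixe, ← hixe]
    simp only [this]
  have hfv : ∀ y, f y ≠ v := fun y => hvlast _ (hix y)
  have hfadj : ∀ y, ¬ G'.Adj (f y) v := by
    intro y hadj
    have hlt := hix y
    refine hmax.prop (HasSpanningCycle.of_crossing (A := l.take (ix y + 1))
      (B := l.drop (ix y + 1)) (u := u) (v := v) (x := f y) (y := y) ?_ ?_ ?_ ?_ ?_ ?_ ?_ ?_ hadj)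
    · simpa using hnd
    · simpa using hmem
    · simpa using hchain
    · simpa [List.head?_take] using hu
    · rw [List.getLast?_take]
      simp [f]
    · rw [List.head?_drop, List.getElem?_eq_getElem hlt, hixe]
    · rw [List.getLast?_drop, if_neg (by omega)]
      exact hv
    · exact (mem_neighborFinset _ _ _).1 y.2
  set X : Finset W := Finset.univ.image f with hX
  have hXcard : X.card = G'.degree u := by
    rw [hX, Finset.card_image_of_injective _ hf, Finset.card_univ, Fintype.card_coe,
      card_neighborFinset_eq_degree]
  have hsum_lt : G'.degree u + G'.degree v < Fintype.card W := by
    have hd : Disjoint X (G'.neighborFinset v) := by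
      rw [Finset.disjoint_left]
      intro x hx hx'
      obtain ⟨y, -, rfl⟩ := Finset.mem_image.1 hx
      exact hfadj y ((mem_neighborFinset _ _ _).1 hx').symm
    rw [← hXcard, ← card_neighborFinset_eq_degree, ← Finset.card_union_of_disjoint hd,
      ← Finset.card_univ]
    refine Finset.card_lt_card (Finset.ssubset_univ_iff.2 fun hun => ?_)
    have := hun ▸ Finset.mem_univ v
    rw [Finset.mem_union] at this
    rcases this with h | h
    · obtain ⟨y, -, hy⟩ := Finset.mem_image.1 h
      exact hfv y hy
    · exact G'.irrefl ((mem_neighborFinset _ _ _).1 h)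
  refine ⟨G'.degree u, (hpos u).trans_le (hdeg u), by omega, ?_, ?_⟩
  · conv_lhs => rw [← hXcard]
    refine Finset.card_le_card fun x hx => ?_
    obtain ⟨y, -, rfl⟩ := Finset.mem_image.1 hx
    have := hsum _ _ (hfv y) (hfadj y)
    have := hdeg (f y)
    simp only [Finset.mem_filter_univ]
    omega
  · have hcompl := Finset.card_compl_add_card (G'.neighborFinset u)
    rw [card_neighborFinset_eq_degree] at hcompl
    rw [← hcompl]
    refine Nat.add_le_add_right (Finset.card_le_card fun x hx => ?_) _
    rw [Finset.mem_compl, mem_neighborFinset] at hx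
    have hxd : G'.degree x ≤ G'.degree v := by
      by_cases hxu : u = x
      · exact hxu ▸ hle'
      · have := hsum _ _ hxu hx
        omega
    have := hdeg x
    rw [Finset.mem_filter_univ]
    omega

end SimpleGraph

/-- If every value of `k` exceeds the sum of the values at the other indices where `k` is no larger,
then the values grow at least like the powers of two. -/
theorem two_pow_card_le_sum_add_one {ι : Type*} [DecidableEq ι] {k : ι → ℕ} (S : Finset ι)
    (hk : ∀ j ∈ S, ∑ i ∈ S with i ≠ j ∧ k i ≤ k j, k i < k j) :
    2 ^ S.card ≤ ∑ i ∈ S, k i + 1 := by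
  induction S using Finset.strongInduction with | _ S ih
  rcases S.eq_empty_or_nonempty with rfl | hS
  · simp
  obtain ⟨j, hj, hmax⟩ := S.exists_max_image k hS
  have hlt := hk j hj
  have hfilter : S.filter (fun i => i ≠ j ∧ k i ≤ k j) = S.erase j := by
    ext i
    simp only [Finset.mem_filter, Finset.mem_erase]
    exact ⟨fun h => ⟨h.2.1, h.1⟩, fun h => ⟨h.2, h.1, hmax i h.2⟩⟩
  rw [hfilter] at hlt
  have := ih _ (Finset.erase_ssubset hj) fun a ha =>
    (Finset.sum_le_sum_of_subset (Finset.filter_subset_filter _ (Finset.erase_subset _ _))).trans_lt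
      (hk a (Finset.mem_of_mem_erase ha))
  rw [← Finset.sum_erase_add _ _ hj, ← Finset.card_erase_add_one hj, pow_succ]
  omega

/-- The vertices of `K_n` together with a vertex adjacent to all of them, joined by the edges of
`K_n` that avoid colour `i`. -/
def avoidingCone {V C : Type*} (c : Sym2 V → C) (i : C) : SimpleGraph (Option V) where
  Adj a b := a ≠ b ∧ ∀ x ∈ a, ∀ y ∈ b, c s(x, y) ≠ i
  symm := ⟨fun _ _ h => ⟨h.1.symm, fun x hx y hy => Sym2.eq_swap ▸ h.2 y hy x hx⟩⟩
  loopless := ⟨fun _ h => h.1 rfl⟩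

theorem avoidsPath_of_hasSpanningCycle {n t : ℕ} {c : Sym2 (Fin n) → Fin t} {i : Fin t}
    (h : (avoidingCone c i).HasSpanningCycle) : AvoidsPath n t n c i := by
  obtain ⟨s, hnd, hmem, hchain⟩ := h
  obtain ⟨l, rfl⟩ : ∃ l : List (Option (Fin n)), s = ((none :: l : List _) : Cycle _) := by
    induction s using Quotient.inductionOn' with | _ m
    obtain ⟨m₁, m₂, rfl⟩ := List.append_of_mem (show none ∈ m from hmem none)
    exact ⟨m₂ ++ m₁, Cycle.coe_eq_coe.2 (by
      rw [← List.cons_append]; exact List.isRotated_append)⟩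
  rw [Cycle.nodup_coe_iff] at hnd
  have hlen : (none :: l).length = n + 1 := by
    rw [← List.toFinset_card_of_nodup hnd]
    trans Fintype.card (Option (Fin n))
    · rw [← Finset.card_univ]
      congr 1
      exact Finset.eq_univ_iff_forall.2 fun w => by simpa using hmem w
    · simp
  rw [List.length_cons, Nat.add_right_cancel_iff] at hlen
  rw [List.nodup_cons] at hnd
  rw [Cycle.chain_coe_cons, List.isChain_cons, List.isChain_append] at hchain
  have hl := List.isChain_iff_getElem.1 hchain.2.1
  have hsome : ∀ k : Fin n, ∃ x, l[k] = some x := fun k =>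
    Option.ne_none_iff_exists'.1 fun h => hnd.1 (h ▸ List.getElem_mem _)
  choose P hP using hsome
  refine ⟨P, fun a b hab => ?_, fun k hk => ?_⟩
  · have : l[a] = l[b] := by rw [hP, hP, hab]
    exact Fin.ext (hnd.2.getElem_inj_iff.1 this)
  · exact (hl k (by omega)).2 _ (hP ⟨k, _⟩) _ (hP ⟨k + 1, hk⟩)

open Classical in
theorem degree_avoidingCone_none {V C : Type*} [Fintype V] (c : Sym2 V → C) (i : C) :
    (avoidingCone c i).degree none = Fintype.card V := by
  rw [← SimpleGraph.card_neighborFinset_eq_degree, ← Finset.card_univ,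
    ← Finset.card_map (s := Finset.univ) Function.Embedding.some]
  refine congrArg Finset.card ?_
  ext (_ | x) <;> rw [SimpleGraph.mem_neighborFinset] <;> simp [avoidingCone]

open Classical in
theorem degree_avoidingCone_some {V C : Type*} [Fintype V] (c : Sym2 V → C) (i : C) (x : V) :
    (avoidingCone c i).degree (some x) + Finset.card {y | y ≠ x ∧ c s(x, y) = i} =
      Fintype.card V := by
  have h : (avoidingCone c i).neighborFinset (some x) =
      insert none (Finset.map Function.Embedding.some {y | y ≠ x ∧ c s(x, y) ≠ i}) := by
    ext (_ | y) <;> rw [SimpleGraph.mem_neighborFinset] <;> simp [avoidingCone, eq_comm]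
  rw [← SimpleGraph.card_neighborFinset_eq_degree, h, Finset.card_insert_of_notMem (by simp),
    Finset.card_map, add_right_comm, ← Finset.card_union_of_disjoint]
  · rw [← Finset.card_univ, ← Finset.card_erase_add_one (Finset.mem_univ x)]
    congr 2
    ext y
    simp
    tauto
  · rw [Finset.disjoint_filter]
    tauto

open Classical in
theorem sum_card_colour {V C : Type*} [Fintype V] [Fintype C] (c : Sym2 V → C) (x : V) :
    ∑ i, Finset.card {y | y ≠ x ∧ c s(x, y) = i} + 1 = Fintype.card V := by
  have := Finset.card_eq_sum_card_fiberwise (f := fun y => c s(x, y)) (s := Finset.univ.erase x)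
    (t := Finset.univ) (fun _ _ => by simp)
  rw [← Finset.card_univ, ← Finset.card_erase_add_one (Finset.mem_univ x), this]
  congr 2
  ext i
  congr 1
  ext y
  simp

/-- If `n ≤ 2^t - 1` then every `t`-colouring of `K_n` contains a Hamilton path avoiding
some colour. -/
theorem hamilton_path_avoiding_colour (t n : ℕ) (ht : 2 ≤ t) (hn : 2 ≤ n)
    (hub : n ≤ 2 ^ t - 1) (c : Sym2 (Fin n) → Fin t) :
    ∃ i : Fin t, AvoidsPath n t n c i := by
  classical
  by_contra! hcon
  let d : Fin t → Fin n → ℕ := fun i x => Finset.card {y | y ≠ x ∧ c s(x, y) = i}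
  have hdeg : ∀ i x, (avoidingCone c i).degree (some x) + d i x = n := fun i x => by
    simpa using degree_avoidingCone_some c i x
  have hdegn : ∀ i, (avoidingCone c i).degree none = n := fun i => by
    simpa using degree_avoidingCone_none c i
  have hsum : ∀ x, ∑ i, d i x + 1 = n := fun x => by simpa using sum_card_colour c x
  have hpair : ∀ x i j, i ≠ j → d i x + d j x < n := fun x i j hij => by
    have := Finset.sum_le_univ_sum_of_nonneg (f := fun i => d i x) (s := {i, j})
      (fun _ => Nat.zero_le _)
    rw [Finset.sum_pair hij] at this
    have := hsum x
    omega
  have hchv : ∀ i, ∃ k, 2 * k ≤ n ∧ k ≤ Finset.card {x | n ≤ d i x + k} ∧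
      n < Finset.card {x | k ≤ d i x} + k := by
    intro i
    obtain ⟨k, hk, hkn, h₁, h₂⟩ :=
      SimpleGraph.exists_le_card_degree_le_of_not_hasSpanningCycle (G := avoidingCone c i)
        (by simpa using hn) (fun h => hcon i (avoidsPath_of_hasSpanningCycle h)) (by
          rintro (_ | x)
          · rw [hdegn]; omega
          · have := hdeg i x
            have := hsum x
            have := Finset.single_le_sum (f := fun i => d i x) (fun _ _ => Nat.zero_le _)
              (Finset.mem_univ i)
            omega)
    simp only [Fintype.card_option, Fintype.card_fin] at hkn h₂
    have hmap : ∀ (p : Option (Fin n) → Prop) (q : Fin n → Prop) [DecidablePred p]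
        [DecidablePred q], ¬ p none → (∀ x, p (some x) → q x) →
        Finset.card {w | p w} ≤ Finset.card {x | q x} := by
      intro p q _ _ hp hpq
      rw [← Finset.card_map (s := Finset.filter q _) Function.Embedding.some]
      refine Finset.card_le_card fun w hw => ?_
      rw [Finset.mem_filter_univ] at hw
      cases w with
      | none => exact absurd hw hp
      | some x => simpa using hpq x hw
    refine ⟨k, by omega, h₁.trans (hmap _ _ ?_ ?_),
      h₂.trans (Nat.add_le_add_right (hmap _ _ ?_ ?_) _)⟩
    · rw [hdegn]; omega
    · intro x hx
      have := hdeg i x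
      omega
    · rw [hdegn]; omega
    · intro x hx
      have := hdeg i x
      omega
  choose k hkn hX hY using hchv
  have hk : ∀ j, ∑ i with i ≠ j ∧ k i ≤ k j, k i < k j := by
    intro j
    let X : Fin t → Finset (Fin n) := fun i => {x | n ≤ d i x + k i}
    let Y : Finset (Fin n) := {x | k j ≤ d j x}
    have hdisj : Disjoint ((Finset.univ.filter fun i => i ≠ j ∧ k i ≤ k j).biUnion X) Y := by
      rw [Finset.disjoint_biUnion_left]
      intro i hi
      rw [Finset.mem_filter_univ] at hi
      rw [Finset.disjoint_filter]
      intro x _ h₁ h₂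
      have := hpair x i j hi.1
      omega
    have hcard := Finset.card_le_univ
      (((Finset.univ.filter fun i => i ≠ j ∧ k i ≤ k j).biUnion X) ∪ Y)
    rw [Finset.card_union_of_disjoint hdisj, Finset.card_biUnion, Fintype.card_fin] at hcard
    · have h₁ := Finset.sum_le_sum fun i (_ : i ∈ Finset.univ.filter fun i => i ≠ j ∧ k i ≤ k j) =>
        hX i
      have h₂ : n < Y.card + k j := hY j
      change _ ≤ ∑ i with i ≠ j ∧ k i ≤ k j, (X i).card at h₁
      omega
    · intro a _ b _ hab
      refine Finset.disjoint_filter.2 fun x _ h₁ h₂ => ?_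
      have := hpair x a b hab
      have := hkn a
      have := hkn b
      omega
  have : Nonempty (Fin t) := ⟨⟨0, by omega⟩⟩
  obtain ⟨j, hj⟩ := Finite.exists_max k
  have h₁ := two_pow_card_le_sum_add_one (k := k) Finset.univ fun j _ => hk j
  have h₂ := hk j
  have hfilter : Finset.univ.filter (fun i => i ≠ j ∧ k i ≤ k j) = Finset.univ.erase j := by
    ext i
    simp [hj i]
  rw [hfilter] at h₂
  rw [← Finset.sum_erase_add _ _ (Finset.mem_univ j), Finset.card_univ, Fintype.card_fin] at h₁
  have := hkn j
  omega
end

section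
/- Let t ≥ 2 and let ℓ ≥ 2 be an even integer. Set N = ℓ + ⌊(ℓ−2)/(2^t−2)⌋. Then every t-colouring of the edges of the complete graph K_N contains a matching with ℓ/2 edges all of whose edges avoid some common colour, i.e., for some i ∈ {1,...,t} there are ℓ/2 pairwise disjoint edges none of which has colour i. -/
open Finset

/-- An involution without fixed points on at least `2 * m` elements has `m` disjoint orbits. -/
theorem exists_transversal_of_involution {V : Type*} [LinearOrder V] {A : Finset V} {p : V → V}
    (hA : ∀ v ∈ A, p v ∈ A) (hp : ∀ v ∈ A, p (p v) = v) (hne : ∀ v ∈ A, p v ≠ v) {m : ℕ}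
    (hm : 2 * m ≤ #A) :
    ∃ a : Fin m → V, Function.Injective a ∧ Function.Injective (p ∘ a) ∧
      (∀ k l, a k ≠ p (a l)) ∧ ∀ k, a k ∈ A := by
  set B := A.filter fun v ↦ v < p v
  have hsub : A ⊆ B ∪ B.image p := by
    intro v hv
    rcases lt_or_gt_of_ne (hne v hv) with h | h
    · refine mem_union_right _ (mem_image.2 ⟨p v, mem_filter.2 ⟨hA v hv, ?_⟩, hp v hv⟩)
      rwa [hp v hv]
    · exact mem_union_left _ (mem_filter.2 ⟨hv, h⟩)
  have hcard : m ≤ #B := by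
    have h1 := card_le_card hsub
    have h2 := card_union_le B (B.image p)
    have h3 : #(B.image p) ≤ #B := card_image_le
    omega
  have hmem (k : Fin m) : B.orderEmbOfFin rfl (Fin.castLE hcard k) ∈ B :=
    B.orderEmbOfFin_mem rfl _
  refine ⟨fun k ↦ B.orderEmbOfFin rfl (Fin.castLE hcard k), ?_, ?_, ?_, ?_⟩
  · exact (B.orderEmbOfFin rfl).injective.comp (Fin.castLE_injective hcard)
  · intro k l hkl
    have h := congrArg p hkl
    simp only [Function.comp_apply] at h
    rw [hp _ (mem_filter.1 (hmem k)).1, hp _ (mem_filter.1 (hmem l)).1] at h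
    exact ((B.orderEmbOfFin rfl).injective.comp (Fin.castLE_injective hcard)) h
  · intro k l hkl
    have hk := mem_filter.1 (hmem k)
    have hl := mem_filter.1 (hmem l)
    have h := congrArg p hkl
    beta_reduce at h hkl
    rw [hp _ hl.1] at h
    have h1 := hk.2
    rw [h, hkl] at h1
    exact lt_asymm h1 hl.2
  · exact fun k ↦ (mem_filter.1 (hmem k)).1

/-- If any two of the labellings `f i` off `S i` are complementary, and each uses at least
`#(S i) + q + 2` labels, then the sizes of the `S i` grow geometrically. -/
theorem two_pow_sub_one_mul_le_of_separations {V ι β : Type*} [Fintype V] [DecidableEq V]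
    [Fintype ι] [Nonempty ι] [DecidableEq ι] [DecidableEq β] {m q : ℕ}
    (hV : Fintype.card V = 2 * m + q) (S : ι → Finset V) (f : ι → V → β)
    (hf : ∀ i j, i ≠ j → ∀ x y, x ∉ S i → x ∉ S j → y ∉ S i → y ∉ S j →
      f i x = f i y ∨ f j x = f j y)
    (hS : ∀ i, #(S i) + q + 2 ≤ #((S i)ᶜ.image (f i))) :
    (2 ^ (Fintype.card ι - 1) - 1) * (q + 1) + 1 ≤ m := by
  have hcompl (i : ι) : #(S i)ᶜ + #(S i) = 2 * m + q := by rw [card_compl_add_card, hV]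
  have hle (i : ι) : #(S i) + 1 ≤ m := by
    have h1 := hS i
    have h2 : #((S i)ᶜ.image (f i)) ≤ #(S i)ᶜ := card_image_le
    have h3 := hcompl i
    omega
  have hU (i : ι) (T : Finset β) : #(S i) + q + 2 ≤ #((S i)ᶜ.filter fun v ↦ f i v ∉ T) + #T := by
    have h1 : (S i)ᶜ.image (f i) \ T ⊆ ((S i)ᶜ.filter fun v ↦ f i v ∉ T).image (f i) := by
      intro b hb
      simp only [mem_sdiff, mem_image, mem_filter] at hb ⊢
      obtain ⟨⟨v, hv, rfl⟩, hb⟩ := hb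
      exact ⟨v, ⟨hv, hb⟩, rfl⟩
    have h2 := (card_le_card h1).trans card_image_le
    have h3 := le_card_sdiff T ((S i)ᶜ.image (f i))
    have h4 := hS i
    omega
  have hlt (i j : ι) (b : β) (h : ∀ v ∉ S i, f i v ≠ b → v ∈ S j) : #(S i) + q + 1 ≤ #(S j) := by
    have h1 : ((S i)ᶜ.filter fun v ↦ f i v ∉ ({b} : Finset β)) ⊆ S j := by
      intro v hv
      simp only [mem_filter, mem_compl, mem_singleton] at hv
      exact h v hv.1 hv.2
    have h2 := card_le_card h1
    have h3 := hU i {b}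
    rw [card_singleton] at h3
    omega
  have hpair (i j : ι) (hij : i ≠ j) : (∃ b, ∀ v ∉ S i, f i v ≠ b → v ∈ S j) ∨
      ∃ b, ∀ v ∉ S j, f j v ≠ b → v ∈ S i := by
    obtain ⟨x, hx⟩ : ∃ x, x ∉ S i ∪ S j := by
      by_contra! h
      have h1 : #(S i ∪ S j) = Fintype.card V := by rw [eq_univ_of_forall h, card_univ]
      have h2 := card_union_le (S i) (S j)
      have h3 := hle i
      have h4 := hle j
      omega
    rw [mem_union, not_or] at hx
    by_contra! h
    obtain ⟨v, hvi, hv, hvj⟩ := h.1 (f i x)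
    obtain ⟨w, hwj, hw, hwi⟩ := h.2 (f j x)
    have h1 := hf i j hij v x hvi hvj hx.1 hx.2
    have h2 := hf i j hij w x hwi hwj hx.1 hx.2
    have h3 := hf i j hij v w hvi hvj hwi hwj
    grind
  have hsub (i j : ι) (hij : i ≠ j) (h : #(S i) ≤ #(S j)) :
      ∃ b, ∀ v ∉ S i, f i v ≠ b → v ∈ S j := by
    refine (hpair i j hij).resolve_right ?_
    rintro ⟨b, hb⟩
    have := hlt j i b hb
    omega
  have huniform (i : ι) : ∃ b, ∀ j, i ≠ j → #(S i) ≤ #(S j) →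
      ∀ v ∉ S i, f i v ≠ b → v ∈ S j := by
    by_cases hi : ∃ j, i ≠ j ∧ #(S i) ≤ #(S j)
    · obtain ⟨j, hij, hj⟩ := hi
      obtain ⟨b, hb⟩ := hsub i j hij hj
      refine ⟨b, fun k hik hk ↦ ?_⟩
      obtain ⟨b', hb'⟩ := hsub i k hik hk
      rcases eq_or_ne b b' with rfl | hne
      · exact hb'
      exfalso
      have h1 : (S i)ᶜ ⊆ S j ∪ S k := by
        intro v hv
        rw [mem_compl] at hv
        rw [mem_union]
        by_cases hvb : f i v = b
        · exact .inr (hb' v hv (hvb ▸ hne))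
        · exact .inl (hb v hv hvb)
      have h2 : ((S i)ᶜ.filter fun v ↦ f i v ∉ ({b, b'} : Finset β)) ⊆ S j ∩ S k := by
        intro v hv
        simp only [mem_filter, mem_compl, mem_insert, mem_singleton, not_or] at hv
        exact mem_inter.2 ⟨hb v hv.1 hv.2.1, hb' v hv.1 hv.2.2⟩
      have h3 := card_le_card h1
      have h4 := card_le_card h2
      have h5 := hU i {b, b'}
      rw [card_pair hne] at h5
      have h6 := card_union_add_card_inter (S j) (S k)
      have h7 := hcompl i
      have h8 := hle j
      have h9 := hle k
      omega
    · push Not at hi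
      obtain ⟨b, -⟩ : ((S i)ᶜ.image (f i)).Nonempty := card_pos.1 (by have := hS i; omega)
      exact ⟨b, fun j hij hj ↦ absurd (hi j hij) hj.not_gt⟩
  choose b hb using huniform
  have hsum (J : Finset ι) (j : ι) (hj : j ∉ J) (hJ : ∀ i ∈ J, #(S i) ≤ #(S j)) :
      ∑ i ∈ J, (#(S i) + q + 1) ≤ #(S j) := by
    set U : ι → Finset V := fun i ↦ (S i)ᶜ.filter fun v ↦ f i v ∉ ({b i} : Finset β) with hUdef
    have hUsub (i k : ι) (hik : i ≠ k) (h : #(S i) ≤ #(S k)) : U i ⊆ S k := by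
      intro v hv
      simp only [hUdef, mem_filter, mem_compl, mem_singleton] at hv
      exact hb i k hik h v hv.1 hv.2
    have hUdisj (k : ι) : Disjoint (S k) (U k) :=
      disjoint_compl_right.mono_right (filter_subset _ _)
    have hdisj : (J : Set ι).PairwiseDisjoint U := by
      intro i _ k _ hik
      rcases le_total #(S i) #(S k) with h | h
      · exact (hUdisj k).mono_left (hUsub i k hik h)
      · exact ((hUdisj i).mono_left (hUsub k i hik.symm h)).symm
    calc ∑ i ∈ J, (#(S i) + q + 1) ≤ ∑ i ∈ J, #(U i) := by
          refine sum_le_sum fun i _ ↦ ?_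
          have := hU i {b i}
          rw [card_singleton] at this
          exact Nat.le_of_add_le_add_right (b := 1) this
      _ = #(J.biUnion U) := (card_biUnion hdisj).symm
      _ ≤ #(S j) := card_le_card <| biUnion_subset.2 fun i hi ↦
          hUsub i j (ne_of_mem_of_not_mem hi hj) (hJ i hi)
  have hpow (J : Finset ι) : 2 ^ #J * (q + 1) ≤ ∑ i ∈ J, (#(S i) + q + 1) + (q + 1) := by
    induction J using Finset.induction_on_max_value (fun i ↦ #(S i)) with
    | empty => simp
    | insert j J hj hJ ih =>
      rw [card_insert_of_notMem hj, sum_insert hj, pow_succ]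
      have := hsum J j hj hJ
      linarith
  obtain ⟨j, -, hj⟩ := exists_max_image univ (fun i ↦ #(S i)) univ_nonempty
  have h1 := hsum (univ.erase j) j (notMem_erase j _) fun i _ ↦ hj i (mem_univ i)
  have h2 := hpow (univ.erase j)
  rw [card_erase_of_mem (mem_univ j), card_univ] at h2
  have h3 := hle j
  rw [Nat.sub_mul, one_mul]
  omega

/-- The join of `G` with a complete graph on `q` new vertices. -/
def addUniversalVerts {V : Type*} (G : SimpleGraph V) (q : ℕ) : SimpleGraph (V ⊕ Fin q) :=
  (Gᶜ ⊕g (⊥ : SimpleGraph (Fin q)))ᶜ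

theorem addUniversalVerts_adj_inl_inl {V : Type*} (G : SimpleGraph V) (q : ℕ) (v w : V) :
    (addUniversalVerts G q).Adj (.inl v) (.inl w) ↔ G.Adj v w := by
  have := G.ne_of_adj (a := v) (b := w)
  simp only [addUniversalVerts, SimpleGraph.compl_adj, SimpleGraph.sum_adj, ne_eq,
    Sum.inl.injEq]
  tauto

theorem addUniversalVerts_adj_inr {V : Type*} (G : SimpleGraph V) {q : ℕ} (k : Fin q)
    {x : V ⊕ Fin q} (hx : x ≠ .inr k) : (addUniversalVerts G q).Adj x (.inr k) := by
  cases x <;> simp_all [addUniversalVerts]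

theorem exists_matching_of_isPerfectMatching_addUniversalVerts {V : Type*} [Fintype V]
    [LinearOrder V] {G : SimpleGraph V} {m q : ℕ} (hV : Fintype.card V = 2 * m + q)
    {M : (addUniversalVerts G q).Subgraph} (hM : M.IsPerfectMatching) :
    ∃ a b : Fin m → V, Function.Injective a ∧ Function.Injective b ∧ (∀ k l, a k ≠ b l) ∧
      ∀ k, G.Adj (a k) (b k) := by
  classical
  rw [SimpleGraph.Subgraph.isPerfectMatching_iff] at hM
  choose p hp hp_unique using fun x ↦ (hM x).exists.imp fun y hy ↦
    (⟨hy, fun z hz ↦ (hM x).unique hz hy⟩ : M.Adj x y ∧ ∀ z, M.Adj x z → z = y)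
  have hpp (x) : p (p x) = x := (hp_unique (p x) x (hp x).symm).symm
  set r : V → V := fun v ↦ (p (.inl v)).elim id fun _ ↦ v with hr
  set A : Finset V := univ.filter fun v ↦ (p (.inl v)).isLeft with hAdef
  have hrA (v) (hv : v ∈ A) : p (.inl v) = .inl (r v) := by
    obtain ⟨w, hw⟩ := Sum.isLeft_iff.1 (mem_filter.1 hv).2
    simp [hr, hw]
  have hrA' (v) (hv : v ∈ A) : p (.inl (r v)) = .inl v := by
    rw [← hrA v hv, hpp]
  have hmem (v) (hv : v ∈ A) : r v ∈ A := by simp [hAdef, hrA' v hv]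
  have hadj (v) (hv : v ∈ A) : G.Adj v (r v) := by
    rw [← addUniversalVerts_adj_inl_inl G q, ← hrA v hv]
    exact (hp _).adj_sub
  have hcard : #Aᶜ ≤ q := by
    calc #Aᶜ ≤ #((univ : Finset (Fin q)).map (Function.Embedding.inr (α := V))) := by
          refine card_le_card_of_injOn (fun v ↦ p (.inl v)) (fun v hv ↦ ?_) fun v _ w _ hvw ↦ ?_
          · have hv : ¬ (p (.inl v)).isLeft := by simpa [hAdef] using hv
            obtain ⟨k, hk⟩ := Sum.isRight_iff.1 (Sum.not_isLeft.1 hv)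
            simp [hk]
          · exact Sum.inl_injective (Function.Involutive.injective hpp hvw)
      _ = q := by simp
  have hA : 2 * m ≤ #A := by
    have := card_add_card_compl A
    omega
  obtain ⟨a, ha, hb, hab, haA⟩ := exists_transversal_of_involution hmem
    (fun v hv ↦ Sum.inl_injective ((hrA _ (hmem v hv)).symm.trans (hrA' v hv)))
    (fun v hv ↦ (hadj v hv).ne') hA
  exact ⟨a, r ∘ a, ha, hb, hab, fun k ↦ hadj _ (haA k)⟩

/-- The hard direction of the Tutte–Berge formula, with the components of `G - S` labelled by
representatives. -/
theorem exists_separation_of_no_matching {V : Type*} [Fintype V] [LinearOrder V]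
    {G : SimpleGraph V} {m q : ℕ} (hV : Fintype.card V = 2 * m + q)
    (hG : ¬ ∃ a b : Fin m → V, Function.Injective a ∧ Function.Injective b ∧
      (∀ k l, a k ≠ b l) ∧ ∀ k, G.Adj (a k) (b k)) :
    ∃ (S : Finset V) (f : V → V), #S + q + 2 ≤ #(Sᶜ.image f) ∧
      ∀ x ∉ S, ∀ y ∉ S, f x ≠ f y → ¬ G.Adj x y := by
  classical
  set H := addUniversalVerts G q
  obtain ⟨u, hu⟩ : ∃ u, H.IsTutteViolator u := by
    by_contra! h
    obtain ⟨M, hM⟩ := SimpleGraph.tutte.2 h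
    exact hG (exists_matching_of_isPerfectMatching_addUniversalVerts hV hM)
  rw [SimpleGraph.IsTutteViolator] at hu
  set K := ((⊤ : H.Subgraph).deleteVerts u).coe
  have hverts (x) : x ∈ ((⊤ : H.Subgraph).deleteVerts u).verts ↔ x ∉ u := by simp
  have hodd := K.odd_ncard_oddComponents
  have hcard : Nat.card ((⊤ : H.Subgraph).deleteVerts u).verts + u.ncard = 2 * (m + q) := by
    have h1 : ((⊤ : H.Subgraph).deleteVerts u).verts = uᶜ := by ext; simp
    have h2 := Set.ncard_add_ncard_compl u
    rw [Nat.card_coe_set_eq, h1]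
    rw [Nat.card_eq_fintype_card, Fintype.card_sum, Fintype.card_fin, hV] at h2
    omega
  have hcomp : u.ncard + 2 ≤ Nat.card K.ConnectedComponent := by
    have h1 : K.oddComponents.ncard ≤ Nat.card K.ConnectedComponent := Set.ncard_le_card _
    rw [Nat.odd_iff, Nat.odd_iff] at hodd
    omega
  have hKadj (x y : ((⊤ : H.Subgraph).deleteVerts u).verts) : K.Adj x y ↔ H.Adj x y := by
    have hx := (hverts x).1 x.2
    have hy := (hverts y).1 y.2
    simp [K, hx, hy]
  have hinr (k : Fin q) : .inr k ∈ u := by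
    by_contra hk
    have hsub : Subsingleton K.ConnectedComponent := by
      suffices h : ∀ x, K.Reachable x ⟨.inr k, (hverts _).2 hk⟩ by
        refine ⟨fun C D ↦ ?_⟩
        induction C using SimpleGraph.ConnectedComponent.ind
        induction D using SimpleGraph.ConnectedComponent.ind
        exact SimpleGraph.ConnectedComponent.eq.2 ((h _).trans (h _).symm)
      intro x
      by_cases hx : x = ⟨.inr k, (hverts _).2 hk⟩
      · rw [hx]
      · exact ((hKadj _ _).2 (addUniversalVerts_adj_inr G k fun h ↦ hx (Subtype.ext h))).reachable
    have := (Finite.card_le_one_iff_subsingleton (α := K.ConnectedComponent)).2 hsub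
    omega
  have hrep (C : K.ConnectedComponent) : ∃ (v : V) (hv : .inl v ∉ u),
      K.connectedComponentMk ⟨.inl v, (hverts _).2 hv⟩ = C := by
    induction C using SimpleGraph.ConnectedComponent.ind with | _ x
    obtain ⟨x | k, hx⟩ := x
    · exact ⟨x, (hverts _).1 hx, rfl⟩
    · exact absurd (hinr k) ((hverts _).1 hx)
  choose g hg hgC using hrep
  have hginj : Function.Injective g := fun C D h ↦ by
    rw [← hgC C, ← hgC D]
    simp only [h]
  set S : Finset V := univ.filter fun v ↦ .inl v ∈ u with hSdef
  have hS (v) : v ∉ S ↔ .inl v ∉ u := by simp [hSdef]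
  have hucard : u.ncard = #S + q := by
    have : u = (S.disjSum (univ : Finset (Fin q)) : Finset (V ⊕ Fin q)) := by
      ext (x | k)
      · simp [hSdef]
      · simp [hinr k]
    rw [this, Set.ncard_coe_finset, card_disjSum, card_univ, Fintype.card_fin]
  set f : V → V := fun v ↦
    if hv : .inl v ∉ u then g (K.connectedComponentMk ⟨.inl v, (hverts _).2 hv⟩) else v
  have hf (v) (hv : .inl v ∉ u) :
      f v = g (K.connectedComponentMk ⟨.inl v, (hverts _).2 hv⟩) := dif_pos hv
  refine ⟨S, f, ?_, fun x hx y hy hxy hadj ↦ hxy ?_⟩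
  · have hsub : univ.image g ⊆ Sᶜ.image f := by
      intro v hv
      obtain ⟨C, -, rfl⟩ := mem_image.1 hv
      exact mem_image.2 ⟨g C, mem_compl.2 ((hS _).2 (hg C)), by rw [hf _ (hg C), hgC]⟩
    have h1 := card_le_card hsub
    rw [card_image_of_injective _ hginj, card_univ, ← Nat.card_eq_fintype_card] at h1
    omega
  · rw [hf x ((hS x).1 hx), hf y ((hS y).1 hy)]
    congr 1
    refine SimpleGraph.ConnectedComponent.eq.2 (SimpleGraph.Adj.reachable ((hKadj _ _).2 ?_))
    exact (addUniversalVerts_adj_inl_inl G q x y).2 hadj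

theorem exists_matching_avoiding_colour {t m q : ℕ} (ht : 0 < t)
    (hq : m ≤ (2 ^ (t - 1) - 1) * (q + 1)) (c : Sym2 (Fin (2 * m + q)) → Fin t) :
    ∃ i : Fin t, ∃ a b : Fin m → Fin (2 * m + q),
      Function.Injective a ∧ Function.Injective b ∧ (∀ k l, a k ≠ b l) ∧
      ∀ k, c s(a k, b k) ≠ i := by
  by_contra! hc
  let G (i : Fin t) : SimpleGraph (Fin (2 * m + q)) :=
    SimpleGraph.fromEdgeSet {e | c e ≠ i}
  have hG (i : Fin t) : ¬ ∃ a b : Fin m → Fin (2 * m + q), Function.Injective a ∧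
      Function.Injective b ∧ (∀ k l, a k ≠ b l) ∧ ∀ k, (G i).Adj (a k) (b k) := by
    rintro ⟨a, b, ha, hb, hab, hadj⟩
    obtain ⟨k, hk⟩ := hc i a b ha hb hab
    exact ((SimpleGraph.fromEdgeSet_adj _).1 (hadj k)).1 hk
  choose S f hS hf using fun i ↦ exists_separation_of_no_matching (Fintype.card_fin _) (hG i)
  have : Nonempty (Fin t) := ⟨⟨0, ht⟩⟩
  have hbound := two_pow_sub_one_mul_le_of_separations (Fintype.card_fin _) S f
    (fun i j hij x y hxi hxj hyi hyj ↦ by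
      by_contra! h
      have hxy : x ≠ y := fun h' ↦ h.1 (h' ▸ rfl)
      have hi := hf i x hxi y hyi h.1
      have hj := hf j x hxj y hyj h.2
      simp only [G, SimpleGraph.fromEdgeSet_adj, Set.mem_ofPred_eq, hxy, ne_eq,
        not_false_eq_true, and_true, not_not] at hi hj
      exact hij (hi.symm.trans hj)) hS
  rw [Fintype.card_fin] at hbound
  omega

/-- For even `ℓ` and `N = ℓ + ⌊(ℓ-2)/(2^t-2)⌋`, every `t`-colouring of `K_N` contains a
matching with `ℓ/2` edges all avoiding a common colour: `ℓ/2` pairwise disjoint edges none of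
which has colour `i`, for some `i`. -/
theorem matching_avoiding_colour (t ℓ : ℕ) (ht : 2 ≤ t) (hℓ : 2 ≤ ℓ) (heven : Even ℓ)
    (c : Sym2 (Fin (ℓ + (ℓ - 2) / (2 ^ t - 2))) → Fin t) :
    ∃ i : Fin t, ∃ a b : Fin (ℓ / 2) → Fin (ℓ + (ℓ - 2) / (2 ^ t - 2)),
      Function.Injective a ∧ Function.Injective b ∧ (∀ k l, a k ≠ b l) ∧
      ∀ k, c s(a k, b k) ≠ i := by
  obtain ⟨m, rfl⟩ := heven.two_dvd
  rw [Nat.mul_div_cancel_left m two_pos]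
  refine exists_matching_avoiding_colour (by omega) ?_ c
  obtain ⟨s, rfl⟩ : ∃ s, t = s + 2 := ⟨t - 2, by omega⟩
  have hpow : 2 ^ (s + 2) = 2 * 2 ^ (s + 1) := pow_succ' 2 (s + 1)
  have hone : 2 ≤ 2 ^ (s + 1) := by rw [pow_succ]; have := Nat.one_le_two_pow (n := s); omega
  have hlt : 2 * m - 2 < (2 ^ (s + 2) - 2) * ((2 * m - 2) / (2 ^ (s + 2) - 2) + 1) :=
    Nat.lt_mul_div_succ _ (by omega)
  generalize (2 * m - 2) / (2 ^ (s + 2) - 2) = q at hlt ⊢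
  have hmul : 2 ^ (s + 2) - 2 = 2 * (2 ^ (s + 1) - 1) := by omega
  rw [hmul, mul_assoc] at hlt
  rw [show s + 2 - 1 = s + 1 from rfl]
  omega
end
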